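/- For every x, y ∈ ℝ and each p ∈ {1, 2}, the inequality sinh(x)·(y − x)/p ≤ (2/e)·cosh(y) − (ln 2)·cosh(x) holds; that is, the hyperbolic cosine function is (2/e, ln 2)-suitable. -/

import Mathlib

/-- The exponential function is `(2/e, ln 2)`-suitable. -/
theorem exp_suitable {p : ℝ} (hp : p = 1 ∨ p = 2) (x y : ℝ) :
    Real.exp x * (Real.log 2 + (y - x) / p) ≤ 2 / Real.exp 1 * Real.exp y := by
  have key : Real.log 2 + (y - x) / p ≤ 2 / Real.exp 1 * Real.exp (y - x) := by
    have h2 : Real.exp (Real.log 2) = 2 := Real.exp_log two_pos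
    rcases hp with rfl | rfl
    · have h := Real.add_one_le_exp (y - x + Real.log 2 - 1)
      rw [Real.exp_sub, Real.exp_add, h2] at h
      linear_combination h
    · have h := Real.add_one_le_exp (y - x + Real.log 2 + Real.log 2 - 1)
      rw [Real.exp_sub, Real.exp_add, Real.exp_add, h2] at h
      linear_combination h / 2
  have hy : Real.exp y = Real.exp x * Real.exp (y - x) := by
    rw [← Real.exp_add, add_sub_cancel]
  rw [hy]
  linear_combination Real.exp x * key

/-- for all `x, y ∈ ℝ` and `p ∈ {1, 2}`,
`sinh(x)·(y − x)/p ≤ (2/e)·cosh(y) − (ln 2)·cosh(x)`; that is, `cosh` is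
`(2/e, ln 2)`-suitable. -/
theorem stmt_12 :
    ∀ p ∈ ({1, 2} : Set ℝ), ∀ x y : ℝ,
      Real.sinh x * (y - x) / p ≤
        (2 / Real.exp 1) * Real.cosh y - Real.log 2 * Real.cosh x := by
  intro p hp x y
  rw [Real.sinh_eq, Real.cosh_eq, Real.cosh_eq]
  linear_combination (exp_suitable hp x y + exp_suitable hp (-x) (-y)) / 2
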